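/- Let Γ be a finite, inseparable, extrusion-irreducible graph having no minor isomorphic to 2C₄ (the quadrilateral with every edge doubled). Then Γ has no 2-separation: no pair of vertices {u, v} separates Γ (equivalently, for every pair of vertices u, v, at most one bridge of {u, v} is not a single edge, so removing u and v leaves a connected graph). -/

import Mathlib

set_option maxHeartbeats 1000000
set_option synthInstance.maxHeartbeats 400000

attribute [local instance] Classical.propDecidable

noncomputable section

/-- A multigraph: loops and multiple edges are allowed.  Each edge `e` has a
reference orientation, from `src e` to `tgt e`. -/
structure MGraph : Type 1 where
  V : Type
  E : Type
  src : E → V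
  tgt : E → V

/-- A class of groups (a property of groups). -/
abbrev GroupClass : Type 1 := (G : Type) → Group G → Prop

/-- A subgroup-closed class of groups. -/
def SubgroupClosed (𝒢 : GroupClass) : Prop :=
  ∀ (G : Type) [instG : Group G], 𝒢 G instG → ∀ H : Subgroup G, 𝒢 H inferInstance

/-- The number of occurrences of `a` in the list `l`. -/
def countIn {α : Type} (l : List α) (a : α) : ℕ :=
  (l.map fun x => if x = a then 1 else 0).sum

namespace MGraph

/-- A step of a walk: an edge together with a direction of traversal
(`true` = from `src` to `tgt`). -/
abbrev Step (Γ : MGraph) : Type := Γ.E × Bool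

def stepStart (Γ : MGraph) (s : Γ.Step) : Γ.V := if s.2 then Γ.src s.1 else Γ.tgt s.1

def stepEnd (Γ : MGraph) (s : Γ.Step) : Γ.V := if s.2 then Γ.tgt s.1 else Γ.src s.1

/-- `IsWalkFrom Γ a b l`: the list of steps `l` is a walk from `a` to `b`. -/
inductive IsWalkFrom (Γ : MGraph) : Γ.V → Γ.V → List Γ.Step → Prop
  | nil (v : Γ.V) : IsWalkFrom Γ v v []
  | cons {a b : Γ.V} {s : Γ.Step} {l : List Γ.Step} :
      Γ.stepStart s = a → IsWalkFrom Γ (Γ.stepEnd s) b l → IsWalkFrom Γ a b (s :: l)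

section Walks

variable (Γ : MGraph)

/-- The list of edges underlying a walk. -/
def walkEdges (l : List Γ.Step) : List Γ.E := l.map Prod.fst

/-- The list of vertices visited by a walk starting at `a`. -/
def walkVerts (a : Γ.V) (l : List Γ.Step) : List Γ.V := a :: l.map Γ.stepEnd

/-- A closed walk (given as its list of steps) is simple if it is nontrivial and
repeats no edge and no vertex (except that initial vertex = final vertex). -/
def IsSimpleClosed (l : List Γ.Step) : Prop :=
  l ≠ [] ∧ (Γ.walkEdges l).Nodup ∧ (l.map Γ.stepStart).Nodup

section Gain

variable {G : Type} [Group G]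

/-- The gain of a single step, for a gain function `g`. -/
def stepGain (g : Γ.E → G) (s : Γ.Step) : G := if s.2 then g s.1 else (g s.1)⁻¹

/-- The gain of a walk: the product of the gains of its steps, in order. -/
def walkGain (g : Γ.E → G) (l : List Γ.Step) : G := (l.map (Γ.stepGain g)).prod

/-- A gain graph is balanced if every simple closed walk has gain `1`. -/
def IsBalanced (g : Γ.E → G) : Prop :=
  ∀ (v : Γ.V) (l : List Γ.Step),
    Γ.IsWalkFrom v v l → Γ.IsSimpleClosed l → Γ.walkGain g l = 1

end Gain

/-- The mod-2 boundary map from edge chains to vertex chains. -/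
def boundary : (Γ.E →₀ ZMod 2) →ₗ[ZMod 2] (Γ.V →₀ ZMod 2) :=
  Finsupp.lsum (ZMod 2) fun e => Finsupp.lsingle (Γ.src e) + Finsupp.lsingle (Γ.tgt e)

/-- The binary cycle space `Z₁(Γ; ℤ₂)`: mod-2 edge chains with even degree at
every vertex. -/
def cycleSpace : Submodule (ZMod 2) (Γ.E →₀ ZMod 2) := LinearMap.ker Γ.boundary

/-- `B` is a basis of the binary cycle space of `Γ`. -/
def IsCycleBasis (B : Set (Γ.E →₀ ZMod 2)) : Prop :=
  (∀ c ∈ B, c ∈ Γ.cycleSpace) ∧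
  LinearIndependent (ZMod 2) (fun c : B => c.1) ∧
  ∀ c ∈ Γ.cycleSpace, c ∈ Submodule.span (ZMod 2) B

/-- The closed walk `l` is a cyclic orientation of the binary cycle `c`:
it is closed and its edge multiplicities reduced mod 2 give `c`. -/
def IsCyclicOrientation (c : Γ.E →₀ ZMod 2) (l : List Γ.Step) : Prop :=
  (∃ v, Γ.IsWalkFrom v v l) ∧ ∀ e : Γ.E, c e = (countIn (Γ.walkEdges l) e : ZMod 2)

/-- The binary cycle `c` is a circle: it is the (indicator of the) edge set of a
simple closed walk. -/
def IsCircleCycle (c : Γ.E →₀ ZMod 2) : Prop :=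
  ∃ l, Γ.IsSimpleClosed l ∧ Γ.IsCyclicOrientation c l

section Tests

variable {G : Type} [Group G]

/-- `B` passes the Binary Cycle Test: it has a cyclic orientation all of whose
closed walks have gain `1`. -/
def PassesBCT (g : Γ.E → G) (B : Set (Γ.E →₀ ZMod 2)) : Prop :=
  ∀ c ∈ B, ∃ l, Γ.IsCyclicOrientation c l ∧ Γ.walkGain g l = 1

/-- The Binary Cycle Test is valid for the gain graph `(Γ, g, G)`. -/
def BCTValid (g : Γ.E → G) : Prop :=
  (∃ B, Γ.IsCycleBasis B ∧ Γ.PassesBCT g B) → Γ.IsBalanced g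

/-- `c` is a circle whose natural traversal as a simple closed walk has gain 1. -/
def IsBalancedCircleCycle (g : Γ.E → G) (c : Γ.E →₀ ZMod 2) : Prop :=
  ∃ l, Γ.IsSimpleClosed l ∧ Γ.IsCyclicOrientation c l ∧ Γ.walkGain g l = 1

/-- The Circle Test is valid for the gain graph `(Γ, g, G)`: if some basis of the
binary cycle space consists of balanced circles, then the gain graph is balanced. -/
def CircleTestValid (g : Γ.E → G) : Prop :=
  (∃ B, Γ.IsCycleBasis B ∧ ∀ c ∈ B, Γ.IsBalancedCircleCycle g c) → Γ.IsBalanced g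

end Tests

/-- The Binary Cycle Test is valid for `Γ` with respect to the class `𝒢`. -/
def BCTValidFor (𝒢 : GroupClass) : Prop :=
  ∀ (G : Type) [instG : Group G], 𝒢 G instG → ∀ g : Γ.E → G, Γ.BCTValid g

/-- The Circle Test is valid for `Γ` with respect to the class `𝒢`
(`Γ` is a "good" graph for `𝒢`). -/
def CircleTestValidFor (𝒢 : GroupClass) : Prop :=
  ∀ (G : Type) [instG : Group G], 𝒢 G instG → ∀ g : Γ.E → G, Γ.CircleTestValid g

/-- Deletion of a set of edges. -/
def deleteEdges (S : Set Γ.E) : MGraph where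
  V := Γ.V
  E := {e : Γ.E // e ∉ S}
  src e := Γ.src e.1
  tgt e := Γ.tgt e.1

/-- The relation identifying the two endpoints of each edge of `S`. -/
def contractRel (S : Set Γ.E) : Γ.V → Γ.V → Prop :=
  fun x y => ∃ e ∈ S, Γ.src e = x ∧ Γ.tgt e = y

/-- Contraction `Γ/S`: vertices in the same component of `(V, S)` are identified
and the edges of `S` are deleted. -/
def contract (S : Set Γ.E) : MGraph where
  V := Quot (Γ.contractRel S)
  E := {e : Γ.E // e ∉ S}
  src e := Quot.mk _ (Γ.src e.1)
  tgt e := Quot.mk _ (Γ.tgt e.1)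

/-- The subgraph with vertex set `U` and edge set the edges of `T` having both
endpoints in `U`. -/
def subgraph (U : Set Γ.V) (T : Set Γ.E) : MGraph where
  V := U
  E := {e : Γ.E // e ∈ T ∧ Γ.src e ∈ U ∧ Γ.tgt e ∈ U}
  src e := ⟨Γ.src e.1, e.2.2.1⟩
  tgt e := ⟨Γ.tgt e.1, e.2.2.2⟩

/-- The set of vertices incident with an edge of `D`. -/
def edgeVerts (D : Set Γ.E) : Set Γ.V := {x | ∃ e ∈ D, Γ.src e = x ∨ Γ.tgt e = x}

/-- The subgraph spanned by an edge set `D`. -/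
def edgeSubgraph (D : Set Γ.E) : MGraph := Γ.subgraph (Γ.edgeVerts D) D

/-- Adjacency of vertices. -/
def Adj (x y : Γ.V) : Prop :=
  ∃ e : Γ.E, (Γ.src e = x ∧ Γ.tgt e = y) ∨ (Γ.src e = y ∧ Γ.tgt e = x)

/-- A graph with no loops. -/
def Loopless : Prop := ∀ e : Γ.E, Γ.src e ≠ Γ.tgt e

/-- A finite graph. -/
def IsFiniteGraph : Prop := Finite Γ.V ∧ Finite Γ.E

/-- A graph is inseparable if any two distinct edges lie in a common circle. -/
def Inseparable : Prop :=
  ∀ e f : Γ.E, e ≠ f →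
    ∃ (v : Γ.V) (l : List Γ.Step), Γ.IsWalkFrom v v l ∧ Γ.IsSimpleClosed l ∧
      e ∈ Γ.walkEdges l ∧ f ∈ Γ.walkEdges l

/-- `D` is (the edge set of) a block of `Γ`: a maximal inseparable subgraph. -/
def IsBlock (D : Set Γ.E) : Prop :=
  (Γ.edgeSubgraph D).Inseparable ∧
  ∀ D', D ⊆ D' → (Γ.edgeSubgraph D').Inseparable → D' = D

/-- The edge set `D` is a circle of `Γ`. -/
def IsCircleSet (D : Set Γ.E) : Prop :=
  ∃ (v : Γ.V) (l : List Γ.Step), Γ.IsWalkFrom v v l ∧ Γ.IsSimpleClosed l ∧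
    D = {e | e ∈ Γ.walkEdges l}

/-- The edge set `D` is a balanced circle for the gain function `g`. -/
def IsBalancedCircleSet {G : Type} [Group G] (g : Γ.E → G) (D : Set Γ.E) : Prop :=
  Γ.IsCircleSet D ∧
  ∀ (v : Γ.V) (l : List Γ.Step), Γ.IsWalkFrom v v l → Γ.IsSimpleClosed l →
    D = {e | e ∈ Γ.walkEdges l} → Γ.walkGain g l = 1

end Walks

/-- An isomorphism of multigraphs (preserving endpoints as unordered pairs). -/
structure Iso (Γ Δ : MGraph) where
  vEquiv : Γ.V ≃ Δ.V
  eEquiv : Γ.E ≃ Δ.E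
  ends_eq : ∀ e : Γ.E,
    s(Δ.src (eEquiv e), Δ.tgt (eEquiv e)) = s(vEquiv (Γ.src e), vEquiv (Γ.tgt e))

/-- `Δ` is a minor of `Γ`: `Δ` is isomorphic to a subgraph of a contraction of `Γ`. -/
def IsMinor (Δ Γ : MGraph) : Prop :=
  ∃ (S : Set Γ.E) (U : Set (Γ.contract S).V) (T : Set (Γ.contract S).E),
    Nonempty (Iso Δ ((Γ.contract S).subgraph U T))

/-- Subdivision of the edge `e₀` into a path of length two. -/
def subdivide (Γ : MGraph) (e₀ : Γ.E) : MGraph where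
  V := Γ.V ⊕ Unit
  E := Γ.E ⊕ Unit
  src := fun e => match e with
    | .inl e => Sum.inl (Γ.src e)
    | .inr _ => Sum.inr ()
  tgt := fun e => match e with
    | .inl e => if e = e₀ then Sum.inr () else Sum.inl (Γ.tgt e)
    | .inr _ => Sum.inl (Γ.tgt e₀)

/-- One subdivision step (up to isomorphism). -/
def SubdivisionStep (A B : MGraph) : Prop :=
  Nonempty (Iso B A) ∨ ∃ e₀ : A.E, Nonempty (Iso B (A.subdivide e₀))

/-- `Δ` is (isomorphic to) a graph obtained from `Γ₀` by subdividing edges. -/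
def IsSubdivisionOf (Δ Γ₀ : MGraph) : Prop :=
  ∃ Δ', Relation.ReflTransGen SubdivisionStep Γ₀ Δ' ∧ Nonempty (Iso Δ Δ')

/-- Two graphs are homeomorphic if both are obtained by subdividing edges of a
common graph. -/
def Homeomorphic (Γ₁ Γ₂ : MGraph) : Prop :=
  ∃ Γ₀, IsSubdivisionOf Γ₁ Γ₀ ∧ IsSubdivisionOf Γ₂ Γ₀

section Ops

variable (Γ : MGraph)

/-- Interchange `u` and `v`. -/
def twistVert (u v x : Γ.V) : Γ.V := if x = u then v else if x = v then u else x

/-- The result of twisting the edge set `A` across `{u, v}`: every endpoint of an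
edge of `A` at `u` is reconnected to `v` and vice versa. -/
def twist (u v : Γ.V) (A : Set Γ.E) : MGraph where
  V := Γ.V
  E := Γ.E
  src e := if e ∈ A then Γ.twistVert u v (Γ.src e) else Γ.src e
  tgt e := if e ∈ A then Γ.twistVert u v (Γ.tgt e) else Γ.tgt e

/-- `x` and `y` are joined by a walk all of whose vertices avoid `u` and `v`. -/
def AvoidConn (u v x y : Γ.V) : Prop :=
  ∃ l, Γ.IsWalkFrom x y l ∧ ∀ z ∈ Γ.walkVerts x l, z ≠ u ∧ z ≠ v

/-- `P` is the vertex set of a union of some, but not all, of the components of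
`Γ ∖ {u, v}` (the data of a Whitney twist across the 2-separation `{u,v}`). -/
def IsWhitneyTwistData (u v : Γ.V) (P : Set Γ.V) : Prop :=
  (∀ x ∈ P, x ≠ u ∧ x ≠ v) ∧
  (∀ x ∈ P, ∀ y, Γ.AvoidConn u v x y → y ∈ P) ∧
  P.Nonempty ∧ (∃ y : Γ.V, y ∉ P ∧ y ≠ u ∧ y ≠ v)

/-- `(v, w, F)` is valid data for extruding the vertex `v`: `w` is a neighbor of
`v` and `F` is a nonempty set of edges joining `v` and `w`. -/
def IsExtrusionData (v w : Γ.V) (F : Set Γ.E) : Prop :=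
  v ≠ w ∧ F.Nonempty ∧
  ∀ e ∈ F, (Γ.src e = v ∧ Γ.tgt e = w) ∨ (Γ.src e = w ∧ Γ.tgt e = v)

/-- Extrusion of a new vertex `v′` from `v`: the edges of `F` are reattached to
join `v′` to `w`, and a new edge joins `v` to `v′`. -/
def extrude (v w : Γ.V) (F : Set Γ.E) : MGraph where
  V := Γ.V ⊕ Unit
  E := Γ.E ⊕ Unit
  src := fun e => match e with
    | .inl e => if e ∈ F ∧ Γ.src e = v then Sum.inr () else Sum.inl (Γ.src e)
    | .inr _ => Sum.inl v
  tgt := fun e => match e with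
    | .inl e => if e ∈ F ∧ Γ.tgt e = v then Sum.inr () else Sum.inl (Γ.tgt e)
    | .inr _ => Sum.inr ()

end Ops

/-- `Δ` is obtained from `Γ` by extruding a vertex (up to isomorphism). -/
def IsExtrusionOf (Δ Γ : MGraph) : Prop :=
  ∃ (v w : Γ.V) (F : Set Γ.E),
    Γ.IsExtrusionData v w F ∧ Nonempty (Iso Δ (Γ.extrude v w F))

/-- `Γ` is extrusion-irreducible: it is not obtainable by extrusion from a
smaller graph. -/
def ExtrusionIrreducible (Γ : MGraph) : Prop := ¬ ∃ Δ : MGraph, IsExtrusionOf Γ Δ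

/-- `Δ` is obtained from `Γ₀` by a (possibly empty) sequence of extrusions,
up to isomorphism. -/
def ObtainedByExtrusions (Δ Γ₀ : MGraph) : Prop :=
  ∃ Δ', Relation.ReflTransGen (fun A B => IsExtrusionOf B A) Γ₀ Δ' ∧ Nonempty (Iso Δ Δ')

section Bridges

variable (Γ : MGraph)

/-- The walk `l` is internally disjoint from `{u, v}`. -/
def IntDisjWalk (u v : Γ.V) (l : List Γ.Step) : Prop :=
  ∀ z ∈ (l.map Γ.stepEnd).dropLast, z ≠ u ∧ z ≠ v

/-- Two edges lie in a common walk internally disjoint from `{u, v}`. -/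
def InBridgeRel (u v : Γ.V) (e f : Γ.E) : Prop :=
  ∃ (a b : Γ.V) (l : List Γ.Step), Γ.IsWalkFrom a b l ∧ Γ.IntDisjWalk u v l ∧
    e ∈ Γ.walkEdges l ∧ f ∈ Γ.walkEdges l

/-- `D` is (the edge set of) a bridge of `{u, v}`: a maximal set of edges any two
of which lie in a common walk internally disjoint from `{u, v}`. -/
def IsBridge (u v : Γ.V) (D : Set Γ.E) : Prop :=
  D.Nonempty ∧ (∀ e ∈ D, ∀ f ∈ D, Γ.InBridgeRel u v e f) ∧
  ∀ D', D ⊆ D' → (∀ e ∈ D', ∀ f ∈ D', Γ.InBridgeRel u v e f) → D' = D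

/-- The set `A` of vertices is connected using only edges of `D`, within `A`. -/
def SetConnWith (D : Set Γ.E) (A : Set Γ.V) : Prop :=
  ∀ x ∈ A, ∀ y ∈ A, ∃ l, Γ.IsWalkFrom x y l ∧ (∀ s ∈ l, s.1 ∈ D) ∧
    ∀ z ∈ Γ.walkVerts x l, z ∈ A

/-- The subgraph with edge set `D` has `2P_{2uv}` (a four-circle with `u`, `v` as
opposite vertices) as a minor rooted at `u` and `v`, expressed by branch sets. -/
def HasRooted2P2Minor (u v : Γ.V) (D : Set Γ.E) : Prop :=
  ∃ β : Fin 4 → Set Γ.V,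
    (∀ i j, i ≠ j → Disjoint (β i) (β j)) ∧
    (∀ i, (β i).Nonempty ∧ Γ.SetConnWith D (β i)) ∧
    u ∈ β 0 ∧ v ∈ β 2 ∧
    ∀ i : Fin 4, ∃ e ∈ D,
      (Γ.src e ∈ β i ∧ Γ.tgt e ∈ β (i + 1)) ∨ (Γ.src e ∈ β (i + 1) ∧ Γ.tgt e ∈ β i)

/-- Removing the vertex `w` disconnects the subgraph with edge set `D`. -/
def SeparatesBridge (D : Set Γ.E) (w : Γ.V) : Prop :=
  ∃ x ∈ Γ.edgeVerts D, ∃ y ∈ Γ.edgeVerts D, x ≠ w ∧ y ≠ w ∧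
    ¬ ∃ l, Γ.IsWalkFrom x y l ∧ (∀ s ∈ l, s.1 ∈ D) ∧ ∀ z ∈ Γ.walkVerts x l, z ≠ w

end Bridges

/-! ### Particular graphs -/

/-- `K₁°`: one vertex with one loop. -/
@[reducible] def loopGraph : MGraph where
  V := Unit
  E := Unit
  src _ := ()
  tgt _ := ()

/-- `mK₂`: two vertices joined by `m` parallel edges. -/
@[reducible] def banana (m : ℕ) : MGraph where
  V := Bool
  E := Fin m
  src _ := false
  tgt _ := true

/-- `C_l(m₁, …, m_l)`: a circle of length `l` whose `i`-th edge is replaced by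
`m i` parallel copies. -/
@[reducible] def multiCircle (l : ℕ) (m : Fin l → ℕ) : MGraph where
  V := Fin l
  E := Σ i : Fin l, Fin (m i)
  src e := e.1
  tgt e := ⟨(e.1.1 + 1) % l, Nat.mod_lt _ e.1.pos⟩

/-- `2C_n`: the circle of length `n` with every edge doubled. -/
@[reducible] def twoCircle (n : ℕ) : MGraph := multiCircle n fun _ => 2

/-- `K₄(m, m′)`: `K₄` with two opposite (nonadjacent) edges replaced by `m` and
`m′` parallel copies respectively. -/
@[reducible] def K4m (m m' : ℕ) : MGraph where
  V := Fin 4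
  E := (Fin m ⊕ Fin m') ⊕ Fin 4
  src := fun e => match e with
    | .inl (.inl _) => 0
    | .inl (.inr _) => 2
    | .inr j => ![0, 0, 1, 1] j
  tgt := fun e => match e with
    | .inl (.inl _) => 1
    | .inl (.inr _) => 3
    | .inr j => ![2, 3, 2, 3] j

/-- `K₄''`: `K₄` with two adjacent edges doubled. -/
@[reducible] def K4dd : MGraph where
  V := Fin 4
  E := Fin 8
  src := ![0, 0, 0, 0, 0, 1, 1, 2]
  tgt := ![1, 1, 2, 2, 3, 2, 3, 3]

/-- The `n`-spoke wheel `W_n`: rim vertices `Fin n` and a hub; `inl i` is the rim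
edge from `v_i` to `v_{i+1}` and `inr i` is the spoke from the hub to `v_i`. -/
@[reducible] def wheel (n : ℕ) : MGraph where
  V := Fin n ⊕ Unit
  E := Fin n ⊕ Fin n
  src := fun e => match e with
    | .inl i => Sum.inl i
    | .inr _ => Sum.inr ()
  tgt := fun e => match e with
    | .inl i => Sum.inl ⟨(i.1 + 1) % n, Nat.mod_lt _ i.pos⟩
    | .inr i => Sum.inl i

instance (n : ℕ) : Finite ((wheel n).E) := inferInstanceAs (Finite (Fin n ⊕ Fin n))

/-- The indicator of an edge set, as a binary chain. -/
def indicatorCycle (Γ : MGraph) [Finite Γ.E] (D : Set Γ.E) : Γ.E →₀ ZMod 2 :=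
  Finsupp.equivFunOnFinite.symm fun e => if e ∈ D then 1 else 0

/-- The edge set of the Hamiltonian circle of `W_n` omitting the rim edge `r`:
all rim edges except `r`, together with the two spokes at the ends of `r`. -/
def wheelHamSet (n : ℕ) (r : Fin n) : Set (wheel n).E :=
  {e | Sum.elim (fun j : Fin n => j ≠ r)
      (fun j : Fin n => j = r ∨ j = ⟨(r.1 + 1) % n, Nat.mod_lt _ r.pos⟩) e}

/-- The set of (indicators of) the `n` Hamiltonian circles of the wheel `W_n`. -/
def wheelHamBasis (n : ℕ) : Set ((wheel n).E →₀ ZMod 2) :=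
  {c | ∃ r : Fin n, c = indicatorCycle (wheel n) (wheelHamSet n r)}

/-- A theta graph: a graph homeomorphic to a triple link. -/
def IsThetaGraph (Δ : MGraph) : Prop := Homeomorphic Δ (banana 3)

end MGraph

end
namespace MGraph

/-- `y` is an end of `e`. -/
def Inc (Γ : MGraph) (e : Γ.E) (y : Γ.V) : Prop := Γ.src e = y ∨ Γ.tgt e = y

/-- `e` joins `y` and `z`. -/
def Joins (Γ : MGraph) (e : Γ.E) (y z : Γ.V) : Prop :=
  (Γ.src e = y ∧ Γ.tgt e = z) ∨ (Γ.src e = z ∧ Γ.tgt e = y)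

/-- Adjacency inside a vertex set. -/
def RIn (Γ : MGraph) (A : Set Γ.V) (x y : Γ.V) : Prop :=
  x ∈ A ∧ y ∈ A ∧ ∃ e, Γ.Joins e x y

/-- Connectivity of a vertex set. -/
def ConnSet (Γ : MGraph) (A : Set Γ.V) : Prop :=
  ∀ x ∈ A, ∀ y ∈ A, Relation.ReflTransGen (Γ.RIn A) x y

theorem Joins.symm {Γ : MGraph} {e : Γ.E} {x y : Γ.V} (h : Γ.Joins e x y) : Γ.Joins e y x :=
  Or.symm h

theorem Joins.inc_left {Γ : MGraph} {e : Γ.E} {x y : Γ.V} (h : Γ.Joins e x y) : Γ.Inc e x :=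
  h.elim (fun h => Or.inl h.1) (fun h => Or.inr h.2)

theorem Joins.inc_right {Γ : MGraph} {e : Γ.E} {x y : Γ.V} (h : Γ.Joins e x y) : Γ.Inc e y :=
  h.symm.inc_left

theorem Inc.joins {Γ : MGraph} {e : Γ.E} {x : Γ.V} (h : Γ.Inc e x) : ∃ y, Γ.Joins e x y :=
  h.elim (fun h => ⟨_, Or.inl ⟨h, rfl⟩⟩) (fun h => ⟨_, Or.inr ⟨rfl, h⟩⟩)

theorem Joins.of_inc {Γ : MGraph} {e : Γ.E} {x y z : Γ.V} (h : Γ.Joins e x y)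
    (hz : Γ.Inc e z) : z = x ∨ z = y := by
  unfold Joins Inc at *; grind

theorem rIn_symm {Γ : MGraph} (A : Set Γ.V) {x y : Γ.V} (h : Γ.RIn A x y) : Γ.RIn A y x := by
  obtain ⟨hx, hy, e, he⟩ := h
  exact ⟨hy, hx, e, he.symm⟩

theorem rtg_symm {Γ : MGraph} {A : Set Γ.V} {x y : Γ.V}
    (h : Relation.ReflTransGen (Γ.RIn A) x y) : Relation.ReflTransGen (Γ.RIn A) y x := by
  induction h with
  | refl => exact .refl
  | tail _ h ih => exact .head (rIn_symm A h) ih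

theorem rtg_mono {Γ : MGraph} {A B : Set Γ.V} (hAB : A ⊆ B) {x y : Γ.V}
    (h : Relation.ReflTransGen (Γ.RIn A) x y) : Relation.ReflTransGen (Γ.RIn B) x y :=
  Relation.ReflTransGen.mono (fun _ _ h => ⟨hAB h.1, hAB h.2.1, h.2.2⟩) _ _ h

/-- The component of `y` in `A`. -/
def comp (Γ : MGraph) (A : Set Γ.V) (y : Γ.V) : Set Γ.V :=
  {z | Relation.ReflTransGen (Γ.RIn A) y z}

theorem comp_subset {Γ : MGraph} {A : Set Γ.V} {y : Γ.V} (hy : y ∈ A) : Γ.comp A y ⊆ A := by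
  intro z hz
  rcases Relation.ReflTransGen.cases_tail hz with h | ⟨w, _, h⟩
  · rw [h]; exact hy
  · exact h.2.1

theorem comp_conn {Γ : MGraph} {A : Set Γ.V} {y : Γ.V} : Γ.ConnSet (Γ.comp A y) := by
  have key : ∀ z, Relation.ReflTransGen (Γ.RIn A) y z →
      Relation.ReflTransGen (Γ.RIn (Γ.comp A y)) y z := by
    intro z hz
    induction hz with
    | refl => exact .refl
    | tail h1 h2 ih => exact ih.tail ⟨h1, h1.tail h2, h2.2.2⟩
  intro x hx z hz
  exact (rtg_symm (key x hx)).trans (key z hz)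

theorem connSet_singleton {Γ : MGraph} (a : Γ.V) : Γ.ConnSet {a} := by
  intro x hx y hy
  rw [hx, hy]

theorem connSet_insert {Γ : MGraph} {A : Set Γ.V} (hA : Γ.ConnSet A) {a x : Γ.V} {e : Γ.E}
    (hx : x ∈ A) (he : Γ.Joins e a x) : Γ.ConnSet (insert a A) := by
  have key : ∀ z ∈ insert a A, Relation.ReflTransGen (Γ.RIn (insert a A)) x z := by
    rintro z (rfl | hz)
    · exact .single ⟨Or.inr hx, Or.inl rfl, e, he.symm⟩
    · exact rtg_mono (Set.subset_insert _ _) (hA x hx z hz)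
  intro y hy z hz
  exact (rtg_symm (key y hy)).trans (key z hz)

theorem connSet_union {Γ : MGraph} {A B : Set Γ.V} (hA : Γ.ConnSet A) (hB : Γ.ConnSet B)
    {x : Γ.V} (hxA : x ∈ A) (hxB : x ∈ B) : Γ.ConnSet (A ∪ B) := by
  have key : ∀ z ∈ A ∪ B, Relation.ReflTransGen (Γ.RIn (A ∪ B)) x z := by
    rintro z (hz | hz)
    · exact rtg_mono Set.subset_union_left (hA x hxA z hz)
    · exact rtg_mono Set.subset_union_right (hB x hxB z hz)
  intro y hy z hz
  exact (rtg_symm (key y hy)).trans (key z hz)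

/-! ### Walks -/

theorem walk_append {Γ : MGraph} {a b c : Γ.V} {l m : List Γ.Step}
    (h : Γ.IsWalkFrom a b l) (h' : Γ.IsWalkFrom b c m) : Γ.IsWalkFrom a c (l ++ m) := by
  induction h with
  | nil => exact h'
  | cons hs _ ih => exact .cons hs (ih h')

theorem walk_split {Γ : MGraph} {a c : Γ.V} {l m : List Γ.Step}
    (h : Γ.IsWalkFrom a c (l ++ m)) : ∃ b, Γ.IsWalkFrom a b l ∧ Γ.IsWalkFrom b c m := by
  induction l generalizing a with
  | nil => exact ⟨a, .nil a, h⟩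
  | cons s l ih =>
    cases h with
    | cons hs h =>
      obtain ⟨b, h1, h2⟩ := ih h
      exact ⟨b, .cons hs h1, h2⟩

theorem inc_stepStart {Γ : MGraph} (s : Γ.Step) : Γ.Inc s.1 (Γ.stepStart s) := by
  unfold Inc stepStart; split <;> simp

theorem inc_stepEnd {Γ : MGraph} (s : Γ.Step) : Γ.Inc s.1 (Γ.stepEnd s) := by
  unfold Inc stepEnd; split <;> simp

theorem joins_step {Γ : MGraph} (s : Γ.Step) : Γ.Joins s.1 (Γ.stepStart s) (Γ.stepEnd s) := by
  unfold Joins stepEnd stepStart; split <;> simp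

theorem Joins.step {Γ : MGraph} {e : Γ.E} {x y : Γ.V} (h : Γ.Joins e x y) :
    ∃ s : Γ.Step, s.1 = e ∧ Γ.stepStart s = x ∧ Γ.stepEnd s = y := by
  rcases h with ⟨h1, h2⟩ | ⟨h1, h2⟩
  · exact ⟨(e, true), rfl, by simp [stepStart, h1], by simp [stepEnd, h2]⟩
  · exact ⟨(e, false), rfl, by simp [stepStart, h2], by simp [stepEnd, h1]⟩

theorem walk_type {Γ : MGraph} {P : Γ.E → Prop} {c : Γ.V}
    (hP : ∀ e f y, P e → ¬ P f → Γ.Inc e y → Γ.Inc f y → y = c)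
    (l : List Γ.Step) : ∀ (a b : Γ.V) (s : Γ.Step), Γ.IsWalkFrom a b (s :: l) →
      (∀ t ∈ l, Γ.stepStart t ≠ c) → ∀ t ∈ l, (P t.1 ↔ P s.1) := by
  induction l with
  | nil => intro a b s _ _ t ht; simp at ht
  | cons r l ih =>
    intro a b s h hc t ht
    cases h with
    | cons hs h =>
      have hr : P r.1 ↔ P s.1 := by
        have hne := hc r (by simp)
        have h1 : Γ.stepStart r = Γ.stepEnd s := by cases h; assumption
        have i1 := inc_stepStart r
        have i2 : Γ.Inc s.1 (Γ.stepStart r) := h1 ▸ inc_stepEnd s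
        by_contra hcon
        by_cases hp : P r.1
        · exact hne (hP _ _ _ hp (by tauto) i1 i2)
        · exact hne (hP _ _ _ (by tauto) hp i2 i1)
      rcases List.mem_cons.1 ht with rfl | ht
      · exact hr
      · exact (ih _ _ r h (fun t ht => hc t (by simp [ht])) t ht).trans hr

theorem cut_lemma {Γ : MGraph} (hins : Γ.Inseparable) {P : Γ.E → Prop} {c : Γ.V}
    (hP : ∀ e f y, P e → ¬ P f → Γ.Inc e y → Γ.Inc f y → y = c)
    {e f : Γ.E} (he : P e) (hf : ¬ P f) : False := by
  obtain ⟨v, l, hw, ⟨hne, -, hnd⟩, hel, hfl⟩ := hins e f (by rintro rfl; exact hf he)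
  -- it suffices to find a rotation
  have key : ∀ (w : Γ.V) (s : Γ.Step) (m : List Γ.Step), Γ.IsWalkFrom w w (s :: m) →
      (∀ t ∈ m, Γ.stepStart t ≠ c) → (∀ t ∈ l, t ∈ s :: m) → False := by
    intro w s m hw hc hsub
    have h1 := walk_type hP m w w s hw hc
    have h2 : ∀ t ∈ l, (P t.1 ↔ P s.1) := by
      intro t ht
      rcases List.mem_cons.1 (hsub t ht) with rfl | h
      · rfl
      · exact h1 t h
    obtain ⟨t, ht, rfl⟩ := List.mem_map.1 hel
    obtain ⟨r, hr, rfl⟩ := List.mem_map.1 hfl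
    exact hf ((h2 r hr).2 ((h2 t ht).1 he))
  by_cases hex : ∃ s ∈ l, Γ.stepStart s = c
  · obtain ⟨s, hs, hsc⟩ := hex
    obtain ⟨l1, l2, rfl⟩ := List.append_of_mem hs
    obtain ⟨b, h1, h2⟩ := walk_split hw
    refine key b s (l2 ++ l1) (walk_append h2 h1) ?_ (by intro t; simp; tauto)
    have hnd' : (((s :: l2) ++ l1).map Γ.stepStart).Nodup :=
      ((List.perm_append_comm.map _).nodup_iff).1 hnd
    simp only [List.cons_append, List.map_cons, List.nodup_cons, List.mem_map] at hnd'
    intro t ht htc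
    exact hnd'.1 ⟨t, ht, htc.trans hsc.symm⟩
  · cases l with
    | nil => exact hne rfl
    | cons s m =>
      exact key v s m hw (fun t ht h => hex ⟨t, by simp [ht], h⟩) (fun t ht => ht)

/-! ### Extrusion -/

theorem extrude_src_inl (Γ : MGraph) (v w : Γ.V) (F : Set Γ.E) (e : Γ.E) :
    (Γ.extrude v w F).src (Sum.inl e) =
      if e ∈ F ∧ Γ.src e = v then Sum.inr () else Sum.inl (Γ.src e) := rfl

theorem extrude_tgt_inl (Γ : MGraph) (v w : Γ.V) (F : Set Γ.E) (e : Γ.E) :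
    (Γ.extrude v w F).tgt (Sum.inl e) =
      if e ∈ F ∧ Γ.tgt e = v then Sum.inr () else Sum.inl (Γ.tgt e) := rfl

theorem extrusion_reducible {Γ : MGraph} (hirr : ExtrusionIrreducible Γ) {x a b : Γ.V}
    (hxa : x ≠ a) (hxb : x ≠ b) (hab : a ≠ b) {e₁ : Γ.E} (he₁ : Γ.Joins e₁ a x)
    (hother : ∀ e, e ≠ e₁ → Γ.Inc e x → Γ.Joins e b x) {e₂ : Γ.E} (he₂ : Γ.Joins e₂ b x) :
    False := by
  have h21 : e₂ ≠ e₁ := by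
    rintro rfl
    unfold Joins at *; grind
  let f : Γ.V → {y : Γ.V // y ≠ x} := fun y => if h : y = x then ⟨a, hxa.symm⟩ else ⟨y, h⟩
  have fx : f x = ⟨a, hxa.symm⟩ := by simp [f]
  have fo : ∀ y (h : y ≠ x), f y = ⟨y, h⟩ := by intro y h; simp [f, h]
  let Δ : MGraph :=
    { V := {y : Γ.V // y ≠ x}
      E := {e : Γ.E // e ≠ e₁}
      src := fun e => f (Γ.src e.1)
      tgt := fun e => f (Γ.tgt e.1) }
  let va : Δ.V := ⟨a, hxa.symm⟩
  let vb : Δ.V := ⟨b, hxb.symm⟩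
  have hvab : va ≠ vb := by
    intro h; exact hab (congrArg Subtype.val h)
  let F : Set Δ.E := {e | Γ.Inc e.1 x}
  have hdata : ∀ e : Δ.E, e ∈ F → (Γ.src e.1 = b ∧ Γ.tgt e.1 = x) ∨
      (Γ.src e.1 = x ∧ Γ.tgt e.1 = b) := fun e he => hother e.1 e.2 he
  refine hirr ⟨Δ, va, vb, F, ⟨hvab, ⟨⟨e₂, h21⟩, he₂.inc_right⟩, ?_⟩, ⟨?_⟩⟩
  · intro e he
    rcases hdata e he with ⟨h1, h2⟩ | ⟨h1, h2⟩
    · right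
      exact ⟨by show f _ = _; rw [h1, fo b hxb.symm], by show f _ = _; rw [h2, fx]⟩
    · left
      exact ⟨by show f _ = _; rw [h1, fx], by show f _ = _; rw [h2, fo b hxb.symm]⟩
  · let vE : Γ.V ≃ Δ.V ⊕ Unit :=
      { toFun := fun y => if h : y = x then Sum.inr () else Sum.inl ⟨y, h⟩
        invFun := Sum.elim (fun y => y.1) (fun _ => x)
        left_inv := by intro y; by_cases h : y = x <;> simp [h]
        right_inv := by
          rintro (⟨y, hy⟩ | _)
          · simp [hy]
          · simp }
    let eE : Γ.E ≃ Δ.E ⊕ Unit :=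
      { toFun := fun y => if h : y = e₁ then Sum.inr () else Sum.inl ⟨y, h⟩
        invFun := Sum.elim (fun y => y.1) (fun _ => e₁)
        left_inv := by intro y; by_cases h : y = e₁ <;> simp [h]
        right_inv := by
          rintro (⟨y, hy⟩ | _)
          · simp [hy]
          · simp }
    have vx : vE x = Sum.inr () := by simp [vE]
    have vo : ∀ y (h : y ≠ x), vE y = Sum.inl ⟨y, h⟩ := by intro y h; simp [vE, h]
    let sr : Δ.E ⊕ Unit → Δ.V ⊕ Unit := (Δ.extrude va vb F).src
    let tg : Δ.E ⊕ Unit → Δ.V ⊕ Unit := (Δ.extrude va vb F).tgt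
    refine ⟨vE, eE, ?_⟩
    intro e
    show s(sr (eE e), tg (eE e)) = s(vE (Γ.src e), vE (Γ.tgt e))
    by_cases h : e = e₁
    · have : eE e = Sum.inr () := by simp [eE, h]
      rw [this]
      have e1 : sr (Sum.inr ()) = Sum.inl va := rfl
      have e2 : tg (Sum.inr ()) = Sum.inr () := rfl
      have hva : vE a = Sum.inl va := vo a hxa.symm
      subst h
      rcases he₁ with ⟨h1, h2⟩ | ⟨h1, h2⟩
      · rw [h1, h2, vx, hva, e1, e2]
      · rw [h1, h2, vx, hva, e1, e2, Sym2.eq_swap]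
    · have : eE e = Sum.inl ⟨e, h⟩ := by simp [eE, h]
      rw [this]
      have e1 : sr (Sum.inl ⟨e, h⟩) =
        if (⟨e, h⟩ : Δ.E) ∈ F ∧ f (Γ.src e) = va then Sum.inr () else Sum.inl (f (Γ.src e)) := by
        refine (extrude_src_inl Δ va vb F ⟨e, h⟩).trans ?_
        congr
      have e2 : tg (Sum.inl ⟨e, h⟩) =
        if (⟨e, h⟩ : Δ.E) ∈ F ∧ f (Γ.tgt e) = va then Sum.inr () else Sum.inl (f (Γ.tgt e)) := by
        refine (extrude_tgt_inl Δ va vb F ⟨e, h⟩).trans ?_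
        congr
      rw [e1, e2]
      have fb : f b = vb := fo b hxb.symm
      have fx' : f x = va := fx
      have hvb : vE b = Sum.inl vb := vo b hxb.symm
      by_cases hF : (⟨e, h⟩ : Δ.E) ∈ F
      · rcases hdata _ hF with ⟨h1, h2⟩ | ⟨h1, h2⟩
        · simp only at h1 h2
          rw [h1, h2, fb, fx', vx, hvb, if_neg (fun hh => hvab hh.2.symm), if_pos ⟨hF, rfl⟩]
        · simp only at h1 h2
          rw [h1, h2, fb, fx', vx, hvb, if_pos ⟨hF, rfl⟩, if_neg (fun hh => hvab hh.2.symm)]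
      · have n1 : Γ.src e ≠ x := fun hh => hF (Or.inl hh)
        have n2 : Γ.tgt e ≠ x := fun hh => hF (Or.inr hh)
        rw [if_neg (fun hh => hF hh.1), if_neg (fun hh => hF hh.1), vo _ n1, vo _ n2,
          fo _ n1, fo _ n2]

/-! ### The rooted minor in a bridge -/

/-- `e` joins some vertex of `A` to some vertex of `B`. -/
def Links (Γ : MGraph) (e : Γ.E) (A B : Set Γ.V) : Prop :=
  (Γ.src e ∈ A ∧ Γ.tgt e ∈ B) ∨ (Γ.src e ∈ B ∧ Γ.tgt e ∈ A)

theorem Links.mono {Γ : MGraph} {e : Γ.E} {A B A' B' : Set Γ.V} (h : Γ.Links e A B)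
    (hA : A ⊆ A') (hB : B ⊆ B') : Γ.Links e A' B' :=
  h.imp (fun h => ⟨hA h.1, hB h.2⟩) (fun h => ⟨hB h.1, hA h.2⟩)

theorem Links.symm {Γ : MGraph} {e : Γ.E} {A B : Set Γ.V} (h : Γ.Links e A B) :
    Γ.Links e B A := Or.symm h

theorem Joins.links {Γ : MGraph} {e : Γ.E} {a x : Γ.V} {A B : Set Γ.V} (h : Γ.Joins e a x)
    (ha : a ∈ A) (hx : x ∈ B) : Γ.Links e A B := by
  unfold Joins Links at *; grind

/-- At least two edges join `A` and `B`. -/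
def Links2 (Γ : MGraph) (A B : Set Γ.V) : Prop :=
  ∃ e f, e ≠ f ∧ Γ.Links e A B ∧ Γ.Links f A B

theorem Links2.mono {Γ : MGraph} {A B A' B' : Set Γ.V} (h : Γ.Links2 A B)
    (hA : A ⊆ A') (hB : B ⊆ B') : Γ.Links2 A' B' := by
  obtain ⟨e, f, h1, h2, h3⟩ := h
  exact ⟨e, f, h1, h2.mono hA hB, h3.mono hA hB⟩

theorem Links2.symm {Γ : MGraph} {A B : Set Γ.V} (h : Γ.Links2 A B) : Γ.Links2 B A := by
  obtain ⟨e, f, h1, h2, h3⟩ := h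
  exact ⟨e, f, h1, h2.symm, h3.symm⟩

/-- The conclusion of the rooted minor lemma. -/
def Rooted (Γ : MGraph) (a b : Γ.V) (C : Set Γ.V) : Prop :=
  ∃ A B W : Set Γ.V, a ∈ A ∧ b ∈ B ∧ W.Nonempty ∧ A ⊆ insert a C ∧ B ⊆ insert b C ∧ W ⊆ C ∧
    Disjoint A B ∧ Disjoint A W ∧ Disjoint B W ∧ Γ.ConnSet A ∧ Γ.ConnSet B ∧ Γ.ConnSet W ∧
    Γ.Links2 A W ∧ Γ.Links2 B W

theorem Rooted.symm {Γ : MGraph} {a b : Γ.V} {C : Set Γ.V} (h : Γ.Rooted a b C) :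
    Γ.Rooted b a C := by
  obtain ⟨A, B, W, h1, h2, h3, h4, h5, h6, h7, h8, h9, h10, h11, h12, h13, h14⟩ := h
  exact ⟨B, A, W, h2, h1, h3, h5, h4, h6, h7.symm, h9, h8, h11, h10, h12, h14, h13⟩

/-- `C` is (the vertex set of) a bridge of `{a, b}`, and `f` lies outside. -/
structure BridgeData (Γ : MGraph) (f : Γ.E) (a b : Γ.V) (C : Set Γ.V) : Prop where
  ha : a ∉ C
  hb : b ∉ C
  conn : Γ.ConnSet C
  closed : ∀ e y z, Γ.Joins e y z → y ∈ C → z ∈ C ∨ z = a ∨ z = b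
  edge : ∃ e y, Γ.Inc e y ∧ y ∈ C
  hf : ∀ y ∈ C, ¬ Γ.Inc f y

theorem BridgeData.symm {Γ : MGraph} {f : Γ.E} {a b : Γ.V} {C : Set Γ.V}
    (h : Γ.BridgeData f a b C) : Γ.BridgeData f b a C :=
  ⟨h.hb, h.ha, h.conn, fun e y z h1 h2 => (h.closed e y z h1 h2).imp_right Or.symm, h.edge, h.hf⟩

theorem BridgeData.attach {Γ : MGraph} (hins : Γ.Inseparable) {f : Γ.E} {a b : Γ.V}
    {C : Set Γ.V} (h : Γ.BridgeData f a b C) : ∃ e x, Γ.Joins e a x ∧ x ∈ C := by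
  by_contra hcon
  push Not at hcon
  obtain ⟨e, y, hey, hy⟩ := h.edge
  refine cut_lemma hins (P := fun e => ∃ y ∈ C, Γ.Inc e y) (c := b) (e := e) (f := f) ?_
    ⟨y, hy, hey⟩ (fun ⟨y, hy, h'⟩ => h.hf y hy h')
  rintro e g z ⟨w, hw, hew⟩ hg hez hgz
  obtain ⟨t, ht⟩ := hew.joins
  have hzC : z ∉ C := fun hz => hg ⟨z, hz, hgz⟩
  rcases ht.of_inc hez with rfl | rfl
  · exact absurd hw hzC
  · rcases h.closed _ _ _ ht hw with h1 | h1 | h1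
    · exact absurd h1 hzC
    · subst h1
      exact absurd hw (hcon _ _ ht.symm)
    · exact h1

theorem rooted_of_bridge {Γ : MGraph} (hfin : Γ.IsFiniteGraph) (hins : Γ.Inseparable)
    (hirr : ExtrusionIrreducible Γ) (f : Γ.E) (n : ℕ) : ∀ (C : Set Γ.V) (a b : Γ.V),
      C.ncard ≤ n → a ≠ b → Γ.BridgeData f a b C → Γ.Rooted a b C := by
  have := hfin.1
  induction n with
  | zero =>
    intro C a b hn hab h
    obtain ⟨e, y, hey, hy⟩ := h.edge
    have : C = ∅ := (Set.ncard_eq_zero (Set.toFinite C)).1 (by omega)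
    rw [this] at hy
    exact absurd hy (Set.notMem_empty y)
  | succ n ih =>
    -- the case of a single attaching edge
    have key : ∀ (C : Set Γ.V) (a b : Γ.V), C.ncard ≤ n + 1 → a ≠ b → Γ.BridgeData f a b C →
        ¬ Γ.Links2 {a} C → Γ.Rooted a b C := by
      intro C a b hn hab h hl
      obtain ⟨e₁, x, he₁, hx⟩ := h.attach hins
      have huniq : ∀ e y, Γ.Joins e a y → y ∈ C → e = e₁ := by
        intro e y he hy
        by_contra hne
        exact hl ⟨e, e₁, hne, he.links rfl hy, he₁.links rfl hx⟩
      have hxa : x ≠ a := by rintro rfl; exact h.ha hx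
      have hxb : x ≠ b := by rintro rfl; exact h.hb hx
      by_cases hC : C = {x}
      · exfalso
        obtain ⟨e₂, x₂, he₂, hx₂⟩ := h.symm.attach hins
        have : x₂ = x := by rw [hC] at hx₂; exact hx₂
        subst this
        refine extrusion_reducible hirr hxa hxb hab he₁ ?_ he₂
        intro e hne hex
        obtain ⟨z, hz⟩ := hex.joins
        rcases h.closed _ _ _ hz hx with h1 | h1 | h1
        · have : z = x₂ := by rw [hC] at h1; exact h1
          subst this
          exfalso
          refine cut_lemma hins (P := fun g => g = e) (c := z) (e := e) (f := e₁) ?_ rfl hne.symm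
          rintro g k y rfl - hg -
          rcases hz.of_inc hg with h | h <;> exact h
        · subst h1
          exact absurd (huniq _ _ hz.symm hx) hne
        · subst h1
          exact hz.symm
      · obtain ⟨y, hy, hyx⟩ : ∃ y ∈ C, y ≠ x := by
          by_contra hcon
          push Not at hcon
          exact hC (Set.eq_singleton_iff_unique_mem.2 ⟨hx, hcon⟩)
        have hyA : y ∈ C \ {x} := ⟨hy, hyx⟩
        set C' := Γ.comp (C \ {x}) y with hC'
        have hsub : C' ⊆ C \ {x} := comp_subset hyA
        have hsubC : C' ⊆ C := hsub.trans Set.sdiff_subset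
        have hxC' : x ∉ C' := fun hh => (hsub hh).2 rfl
        have hyC' : y ∈ C' := Relation.ReflTransGen.refl
        have hcard : C'.ncard ≤ n := by
          have : C'.ncard < C.ncard := Set.ncard_lt_ncard
            ⟨hsubC, fun hh => hxC' (hh hx)⟩ (Set.toFinite C)
          omega
        have hB : Γ.BridgeData f x b C' := by
          refine ⟨hxC', fun hh => h.hb (hsubC hh), comp_conn, ?_, ?_, fun z hz => h.hf z (hsubC hz)⟩
          · intro e z w he hz
            rcases h.closed e z w he (hsubC hz) with h1 | h1 | h1
            · by_cases hwx : w = x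
              · exact Or.inr (Or.inl hwx)
              · left
                exact Relation.ReflTransGen.tail hz ⟨hsub hz, ⟨h1, hwx⟩, e, he⟩
            · subst h1
              have := huniq e z he.symm (hsubC hz)
              subst this
              rcases he₁.of_inc he.inc_left with h2 | h2
              · subst h2
                exact absurd (hsubC hz) h.ha
              · subst h2
                exact absurd hz hxC'
            · exact Or.inr (Or.inr h1)
          · rcases Relation.ReflTransGen.cases_head (h.conn y hy x hx) with h1 | ⟨w, ⟨_, _, e, he⟩, _⟩
            · exact absurd h1 hyx
            · exact ⟨e, y, he.inc_left, hyC'⟩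
        obtain ⟨A, B, W, h1, h2, h3, h4, h5, h6, h7, h8, h9, h10, h11, h12, h13, h14⟩ :=
          ih C' x b hcard hxb hB
        have haW : a ∉ W := fun hh => h.ha (hsubC (h6 hh))
        have haB : a ∉ B := fun hh => (h5 hh).elim hab (fun h' => h.ha (hsubC h'))
        refine ⟨insert a A, B, W, Or.inl rfl, h2, h3, ?_, ?_, h6.trans hsubC, ?_, ?_, h9,
          connSet_insert h10 h1 he₁, h11, h12, h13.mono (Set.subset_insert _ _) le_rfl, h14⟩
        · refine Set.insert_subset_insert (h4.trans ?_)
          exact Set.insert_subset hx hsubC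
        · exact h5.trans (Set.insert_subset_insert hsubC)
        · exact Set.disjoint_insert_left.2 ⟨haB, h7⟩
        · exact Set.disjoint_insert_left.2 ⟨haW, h8⟩
    intro C a b hn hab h
    by_cases h1 : Γ.Links2 {a} C
    · by_cases h2 : Γ.Links2 {b} C
      · obtain ⟨e, y, hey, hy⟩ := h.edge
        exact ⟨{a}, {b}, C, rfl, rfl, ⟨y, hy⟩, by simp, by simp, le_rfl, by simpa using hab,
          by simpa using h.ha, by simpa using h.hb, connSet_singleton a, connSet_singleton b,
          h.conn, h1, h2⟩
      · exact (key C b a hn hab.symm h.symm h2).symm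
    · exact key C a b hn hab h h1

/-! ### Building the minor -/

theorem minor_of_branch {Γ : MGraph} (β : Fin 4 → Set Γ.V)
    (hdisj : ∀ i j, i ≠ j → Disjoint (β i) (β j))
    (hne : ∀ i, (β i).Nonempty) (hconn : ∀ i, Γ.ConnSet (β i))
    (hl : ∀ i, Γ.Links2 (β i) (β (i + 1))) : (twoCircle 4).IsMinor Γ := by
  choose r hr using hne
  choose p q hpq hp hq using hl
  let ed : (Σ _ : Fin 4, Fin 2) → Γ.E := fun k => if k.2 = 0 then p k.1 else q k.1
  have hed : ∀ k, Γ.Links (ed k) (β k.1) (β (k.1 + 1)) := by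
    intro k
    by_cases h : k.2 = 0
    · simp only [ed, h, if_true]; exact hp _
    · simp only [ed, h, if_false]; exact hq _
  let S : Set Γ.E := {e | ∃ i, Γ.src e ∈ β i ∧ Γ.tgt e ∈ β i}
  have huniq : ∀ {x i j}, x ∈ β i → x ∈ β j → i = j := by
    intro x i j h1 h2
    by_contra hh
    exact Set.disjoint_left.1 (hdisj i j hh) h1 h2
  have hsucc : ∀ i : Fin 4, i ≠ i + 1 := by decide
  have hsucc2 : ∀ i j : Fin 4, i = j + 1 → j = i + 1 → False := by decide
  have hedS : ∀ k, ed k ∉ S := by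
    rintro k ⟨i, h1, h2⟩
    rcases hed k with ⟨h3, h4⟩ | ⟨h3, h4⟩
    · exact hsucc k.1 ((huniq h3 h1).trans (huniq h2 h4))
    · exact hsucc k.1 ((huniq h4 h2).trans (huniq h1 h3))
  have hinj : Function.Injective ed := by
    have hfst : ∀ k m, ed k = ed m → k.1 = m.1 := by
      intro k m h
      have h1 := hed k
      have h2 := hed m
      rw [h] at h1
      rcases h1 with ⟨h3, h4⟩ | ⟨h3, h4⟩ <;> rcases h2 with ⟨h5, h6⟩ | ⟨h5, h6⟩
      · exact huniq h3 h5
      · exact (hsucc2 _ _ (huniq h3 h5) (huniq h4 h6).symm).elim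
      · exact (hsucc2 _ _ (huniq h4 h6) (huniq h3 h5).symm).elim
      · exact huniq h4 h6
    rintro ⟨i, s⟩ ⟨j, t⟩ h
    obtain rfl : i = j := hfst _ _ h
    have : s = t := by
      fin_cases s <;> fin_cases t <;> simp [ed] at h ⊢
      · exact hpq _ h
      · exact hpq _ h.symm
    rw [this]
  -- quotient facts
  have hq1 : ∀ i, ∀ x ∈ β i, (Quot.mk (Γ.contractRel S) x) = Quot.mk _ (r i) := by
    intro i x hx
    have := hconn i x hx (r i) (hr i)
    induction this using Relation.ReflTransGen.head_induction_on with
    | refl => rfl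
    | head h _ ih =>
      obtain ⟨h1, h2, e, he⟩ := h
      refine Eq.trans ?_ (ih h2)
      rcases he with ⟨h3, h4⟩ | ⟨h3, h4⟩
      · exact Quot.sound ⟨e, ⟨i, h3 ▸ h1, h4 ▸ h2⟩, h3, h4⟩
      · exact (Quot.sound ⟨e, ⟨i, h3 ▸ h2, h4 ▸ h1⟩, h3, h4⟩).symm
  let cl : Quot (Γ.contractRel S) → Set (Fin 4) := Quot.lift (fun x => {i | x ∈ β i}) (by
    rintro x y ⟨e, ⟨i, h1, h2⟩, rfl, rfl⟩
    ext j
    constructor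
    · intro hj
      obtain rfl := huniq h1 hj
      exact h2
    · intro hj
      obtain rfl := huniq h2 hj
      exact h1)
  have hq2 : ∀ i j, (Quot.mk (Γ.contractRel S) (r i)) = Quot.mk _ (r j) → i = j := by
    intro i j h
    have h1 : cl (Quot.mk _ (r i)) = cl (Quot.mk _ (r j)) := congrArg cl h
    have h2 : j ∈ cl (Quot.mk _ (r j)) := hr j
    rw [← h1] at h2
    exact huniq (hr i) h2
  let g : Fin 4 → Quot (Γ.contractRel S) := fun i => Quot.mk _ (r i)
  have hginj : Function.Injective g := hq2
  let ed' : (Σ _ : Fin 4, Fin 2) → (Γ.contract S).E := fun k => ⟨ed k, hedS k⟩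
  have hinj' : Function.Injective ed' := fun k m h => hinj (congrArg Subtype.val h)
  have hends : ∀ k, ((Γ.contract S).src (ed' k) = g k.1 ∧ (Γ.contract S).tgt (ed' k) = g (k.1 + 1)) ∨
      ((Γ.contract S).src (ed' k) = g (k.1 + 1) ∧ (Γ.contract S).tgt (ed' k) = g k.1) := by
    intro k
    rcases hed k with ⟨h1, h2⟩ | ⟨h1, h2⟩
    · exact Or.inl ⟨hq1 _ _ h1, hq1 _ _ h2⟩
    · exact Or.inr ⟨hq1 _ _ h1, hq1 _ _ h2⟩
  refine ⟨S, Set.range g, Set.range ed', ⟨⟨Equiv.ofInjective g hginj, ?_, ?_⟩⟩⟩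
  · refine Equiv.ofBijective (fun k => ⟨ed' k, ⟨k, rfl⟩, ?_, ?_⟩) ⟨?_, ?_⟩
    · rcases hends k with ⟨h, -⟩ | ⟨h, -⟩ <;> rw [h] <;> exact ⟨_, rfl⟩
    · rcases hends k with ⟨-, h⟩ | ⟨-, h⟩ <;> rw [h] <;> exact ⟨_, rfl⟩
    · intro k m h
      exact hinj' (congrArg Subtype.val h)
    · rintro ⟨_, ⟨k, rfl⟩, _, _⟩
      exact ⟨k, rfl⟩
  · intro k
    have ht : (twoCircle 4).tgt k = k.1 + 1 := by
      rcases k with ⟨i, s⟩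
      fin_cases i <;> rfl
    have hs : (twoCircle 4).src k = k.1 := rfl
    rw [ht, hs]
    rcases hends k with ⟨h1, h2⟩ | ⟨h1, h2⟩
    · rw [Sym2.eq_iff]
      left
      exact ⟨Subtype.ext h1, Subtype.ext h2⟩
    · rw [Sym2.eq_iff]
      right
      exact ⟨Subtype.ext h1, Subtype.ext h2⟩

/-! ### Bridges as edge sets -/

theorem bridge_walk_head {Γ : MGraph} {u v : Γ.V} (l : List Γ.Step) :
    ∀ (a b : Γ.V) (s : Γ.Step), Γ.IsWalkFrom a b (s :: l) → Γ.IntDisjWalk u v (s :: l) →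
      ∀ t ∈ l, Γ.stepEnd s ∈ ({u, v}ᶜ : Set Γ.V) ∧
        ∃ z, Γ.Inc t.1 z ∧ Relation.ReflTransGen (Γ.RIn {u, v}ᶜ) (Γ.stepEnd s) z := by
  induction l with
  | nil => intro a b s _ _ t ht; simp at ht
  | cons r l ih =>
    intro a b s h hd t ht
    have hs : Γ.stepEnd s ∈ ({u, v}ᶜ : Set Γ.V) := by
      have := hd (Γ.stepEnd s) (by simp)
      simpa using this
    refine ⟨hs, ?_⟩
    cases h with
    | cons _ h =>
      have h1 : Γ.stepStart r = Γ.stepEnd s := by cases h; assumption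
      rcases List.mem_cons.1 ht with rfl | ht
      · exact ⟨_, inc_stepStart t, by rw [h1]⟩
      · have hd' : Γ.IntDisjWalk u v (r :: l) := by
          intro z hz
          apply hd
          simp only [List.map_cons] at hz ⊢
          rw [List.dropLast_cons_of_ne_nil (by simp)]
          exact List.mem_cons_of_mem _ hz
        obtain ⟨hr, z, hz, hzz⟩ := ih _ _ r h hd' t ht
        exact ⟨z, hz, .head ⟨hs, hr, r.1, h1 ▸ joins_step r⟩ hzz⟩

theorem bridgeRel_conn {Γ : MGraph} {u v : Γ.V} {e f : Γ.E} (h : Γ.InBridgeRel u v e f)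
    (hne : e ≠ f) : ∃ y z, Γ.Inc e y ∧ Γ.Inc f z ∧ y ∈ ({u, v}ᶜ : Set Γ.V) ∧
      Relation.ReflTransGen (Γ.RIn {u, v}ᶜ) y z := by
  obtain ⟨a, b, l, hw, hd, he, hf⟩ := h
  induction l generalizing a with
  | nil => simp [walkEdges] at he
  | cons s l ih =>
    have head := bridge_walk_head l a b s hw hd
    simp only [walkEdges, List.map_cons, List.mem_cons] at he hf
    rcases he with rfl | he <;> rcases hf with rfl | hf
    · exact absurd rfl hne
    · obtain ⟨t, ht, rfl⟩ := List.mem_map.1 hf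
      obtain ⟨h1, z, h2, h3⟩ := head t ht
      exact ⟨_, z, inc_stepEnd s, h2, h1, h3⟩
    · obtain ⟨t, ht, rfl⟩ := List.mem_map.1 he
      obtain ⟨h1, z, h2, h3⟩ := head t ht
      exact ⟨z, _, h2, inc_stepEnd s, comp_subset h1 h3, rtg_symm h3⟩
    · cases hw with
      | cons _ hw =>
        refine ih _ hw ?_ he hf
        intro z hz
        apply hd
        have hl : l ≠ [] := by rintro rfl; simp at he
        rw [List.map_cons, List.dropLast_cons_of_ne_nil (by simpa using hl)]
        exact List.mem_cons_of_mem _ hz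

theorem walk_of_rtg {Γ : MGraph} {A : Set Γ.V} {y z : Γ.V} (hz : z ∈ A)
    (h : Relation.ReflTransGen (Γ.RIn A) y z) :
    ∃ l, Γ.IsWalkFrom y z l ∧ ∀ w ∈ Γ.walkVerts y l, w ∈ A := by
  induction h using Relation.ReflTransGen.head_induction_on with
  | refl => exact ⟨[], .nil _, by simpa [walkVerts] using hz⟩
  | head h _ ih =>
    obtain ⟨l, h1, h2⟩ := ih
    obtain ⟨h3, h4, e, he⟩ := h
    obtain ⟨s, rfl, hs1, hs2⟩ := he.step
    refine ⟨s :: l, .cons hs1 (hs2 ▸ h1), ?_⟩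
    intro w hw
    rcases List.mem_cons.1 hw with rfl | hw
    · exact h3
    · apply h2
      simpa [walkVerts, hs2] using hw

theorem bridgeRel_of_conn {Γ : MGraph} {u v : Γ.V} {e f : Γ.E} {y z : Γ.V}
    (hey : Γ.Inc e y) (hfz : Γ.Inc f z) (hy : y ∈ ({u, v}ᶜ : Set Γ.V))
    (h : Relation.ReflTransGen (Γ.RIn {u, v}ᶜ) y z) : Γ.InBridgeRel u v e f := by
  obtain ⟨l, hl, hv⟩ := walk_of_rtg (comp_subset hy h) h
  obtain ⟨y', hy'⟩ := hey.joins
  obtain ⟨z', hz'⟩ := hfz.joins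
  obtain ⟨s, rfl, hs1, hs2⟩ := hy'.symm.step
  obtain ⟨t, rfl, ht1, ht2⟩ := hz'.step
  refine ⟨y', z', s :: (l ++ [t]), .cons hs1 (hs2 ▸ walk_append hl (.cons ht1 (ht2 ▸ .nil _))),
    ?_, by simp [walkEdges], by simp [walkEdges]⟩
  intro w hw
  have : ((s :: (l ++ [t])).map Γ.stepEnd).dropLast = Γ.walkVerts y l := by
    have e1 : (s :: (l ++ [t])).map Γ.stepEnd = (y :: l.map Γ.stepEnd) ++ [Γ.stepEnd t] := by
      simp [hs2]
    rw [e1, List.dropLast_concat]; rfl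
  rw [this] at hw
  simpa using hv w hw

theorem bridge_comp {Γ : MGraph} {u v : Γ.V} {D : Set Γ.E} (hD : Γ.IsBridge u v D)
    (hns : ¬ ∃ e : Γ.E, D = {e}) : ∃ y ∈ ({u, v}ᶜ : Set Γ.V),
      D = {e | ∃ z ∈ Γ.comp {u, v}ᶜ y, Γ.Inc e z} ∧ ∃ e, Γ.Inc e y := by
  obtain ⟨⟨e, he⟩, hrel, hmax⟩ := hD
  obtain ⟨f, hf, hfe⟩ : ∃ f ∈ D, f ≠ e := by
    by_contra hcon
    push Not at hcon
    exact hns ⟨e, Set.eq_singleton_iff_unique_mem.2 ⟨he, hcon⟩⟩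
  obtain ⟨y, z, hey, hfz, hy, hyz⟩ := bridgeRel_conn (hrel e he f hf) hfe.symm
  refine ⟨y, hy, ?_, e, hey⟩
  symm
  apply hmax
  · intro g hg
    by_cases hge : g = e
    · subst hge
      exact ⟨y, .refl, hey⟩
    · obtain ⟨y', z', h1, h2, h3, h4⟩ := bridgeRel_conn (hrel e he g hg) (Ne.symm hge)
      refine ⟨z', ?_, h2⟩
      refine Relation.ReflTransGen.trans ?_ h4
      obtain ⟨w, hw⟩ := hey.joins
      rcases hw.of_inc h1 with rfl | rfl
      · exact .refl
      · exact .single ⟨hy, h3, e, hw⟩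
  · rintro g ⟨z, hz, hgz⟩ k ⟨w, hw, hkw⟩
    exact bridgeRel_of_conn hgz hkw (comp_subset hy hz) ((rtg_symm hz).trans hw)

theorem comp_closed {Γ : MGraph} {u v y₀ : Γ.V} (h0 : y₀ ∈ ({u, v}ᶜ : Set Γ.V)) :
    ∀ e y z, Γ.Joins e y z → y ∈ Γ.comp {u, v}ᶜ y₀ → z ∈ Γ.comp {u, v}ᶜ y₀ ∨ z = u ∨ z = v := by
  intro e y z he hy
  by_cases hz : z ∈ ({u, v}ᶜ : Set Γ.V)
  · exact Or.inl (Relation.ReflTransGen.tail hy ⟨comp_subset h0 hy, hz, e, he⟩)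
  · right
    simpa using Set.notMem_compl_iff.1 hz

theorem comp_bridgeData {Γ : MGraph} {u v y₀ y₁ : Γ.V} (h0 : y₀ ∈ ({u, v}ᶜ : Set Γ.V))
    (h1 : y₁ ∈ ({u, v}ᶜ : Set Γ.V)) (h01 : y₁ ∉ Γ.comp {u, v}ᶜ y₀)
    {e f : Γ.E} (he : Γ.Inc e y₀) (hf : Γ.Inc f y₁) :
    Γ.BridgeData f u v (Γ.comp {u, v}ᶜ y₀) := by
  refine ⟨fun h => ?_, fun h => ?_, comp_conn, comp_closed h0, ⟨e, y₀, he, .refl⟩, ?_⟩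
  · have := comp_subset h0 h; simp at this
  · have := comp_subset h0 h; simp at this
  · intro y hy hfy
    obtain ⟨w, hw⟩ := hfy.joins
    rcases hw.of_inc hf with rfl | rfl
    · exact h01 hy
    · rcases comp_closed h0 f _ _ hw hy with h | h | h
      · exact h01 h
      · simp [h] at h1
      · simp [h] at h1

end MGraph

/-- A finite, inseparable, extrusion-irreducible graph with no
`2C₄` minor has no 2-separation: for every pair of vertices `{u, v}`, at most
one bridge of `{u, v}` is not a single edge. -/
theorem no_two_separation (Γ : MGraph) (hfin : Γ.IsFiniteGraph)
    (hins : Γ.Inseparable) (hirr : MGraph.ExtrusionIrreducible Γ)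
    (hminor : ¬ (MGraph.twoCircle 4).IsMinor Γ) :
    ∀ (u v : Γ.V) (D₁ D₂ : Set Γ.E), Γ.IsBridge u v D₁ → Γ.IsBridge u v D₂ →
      (¬ ∃ e : Γ.E, D₁ = {e}) → (¬ ∃ e : Γ.E, D₂ = {e}) → D₁ = D₂ := by
  intro u v D₁ D₂ hD₁ hD₂ hn₁ hn₂
  obtain ⟨y₁, hy₁, hE₁, e₁, he₁⟩ := MGraph.bridge_comp hD₁ hn₁
  obtain ⟨y₂, hy₂, hE₂, e₂, he₂⟩ := MGraph.bridge_comp hD₂ hn₂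
  by_cases h12 : y₂ ∈ Γ.comp {u, v}ᶜ y₁
  · have : Γ.comp {u, v}ᶜ y₁ = Γ.comp {u, v}ᶜ y₂ := by
      ext z
      exact ⟨fun h => (MGraph.rtg_symm h12).trans h, fun h => Relation.ReflTransGen.trans h12 h⟩
    rw [hE₁, hE₂, this]
  exfalso
  have h21 : y₁ ∉ Γ.comp {u, v}ᶜ y₂ := fun h => h12 (MGraph.rtg_symm h)
  have b₁ := MGraph.comp_bridgeData hy₁ hy₂ h12 he₁ he₂
  have b₂ := MGraph.comp_bridgeData hy₂ hy₁ h21 he₂ he₁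
  have hdC : ∀ z, z ∈ Γ.comp {u, v}ᶜ y₁ → z ∈ Γ.comp {u, v}ᶜ y₂ → False := fun z h h' =>
    h12 (Relation.ReflTransGen.trans h (MGraph.rtg_symm h'))
  generalize Γ.comp {u, v}ᶜ y₁ = C₁ at *
  generalize Γ.comp {u, v}ᶜ y₂ = C₂ at *
  by_cases huv : u = v
  · subst huv
    obtain ⟨e, y, hey, hy⟩ := b₁.edge
    refine MGraph.cut_lemma hins (P := fun e => ∃ y ∈ C₁, Γ.Inc e y) (c := u) (e := e)
      (f := e₂) ?_ ⟨y, hy, hey⟩ (fun ⟨y, hy, h'⟩ => b₁.hf y hy h')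
    rintro e g z ⟨w, hw, hew⟩ hg hez hgz
    obtain ⟨t, ht⟩ := hew.joins
    have hzC : z ∉ C₁ := fun hz => hg ⟨z, hz, hgz⟩
    rcases ht.of_inc hez with rfl | rfl
    · exact absurd hw hzC
    · rcases b₁.closed _ _ _ ht hw with h1 | h1 | h1
      · exact absurd h1 hzC
      · exact h1
      · exact h1
  obtain ⟨A, B, W, h1, h2, h3, h4, h5, h6, h7, h8, h9, h10, h11, h12', h13, h14⟩ :=
    MGraph.rooted_of_bridge hfin hins hirr e₂ _ C₁ u v le_rfl huv b₁
  obtain ⟨A', B', W', k1, k2, k3, k4, k5, k6, k7, k8, k9, k10, k11, k12, k13, k14⟩ :=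
    MGraph.rooted_of_bridge hfin hins hirr e₁ _ C₂ u v le_rfl huv b₂
  have hu₁ := b₁.ha
  have hv₁ := b₁.hb
  have hu₂ := b₂.ha
  have hv₂ := b₂.hb
  have d01 : Disjoint (A ∪ A') W := by
    rw [Set.disjoint_left] at *; intro x hx hx'
    rcases hx with hx | hx
    · exact h8 hx hx'
    · rcases k4 hx with rfl | h
      · exact hu₁ (h6 hx')
      · exact hdC _ (h6 hx') h
  have d03 : Disjoint (A ∪ A') W' := by
    rw [Set.disjoint_left] at *; intro x hx hx'
    rcases hx with hx | hx
    · rcases h4 hx with rfl | h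
      · exact hu₂ (k6 hx')
      · exact hdC _ h (k6 hx')
    · exact k8 hx hx'
  have d21 : Disjoint (B ∪ B') W := by
    rw [Set.disjoint_left] at *; intro x hx hx'
    rcases hx with hx | hx
    · exact h9 hx hx'
    · rcases k5 hx with rfl | h
      · exact hv₁ (h6 hx')
      · exact hdC _ (h6 hx') h
  have d23 : Disjoint (B ∪ B') W' := by
    rw [Set.disjoint_left] at *; intro x hx hx'
    rcases hx with hx | hx
    · rcases h5 hx with rfl | h
      · exact hv₂ (k6 hx')
      · exact hdC _ h (k6 hx')
    · exact k9 hx hx'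
  have d13 : Disjoint W W' := by
    rw [Set.disjoint_left]; intro x hx hx'
    exact hdC _ (h6 hx) (k6 hx')
  have d02 : Disjoint (A ∪ A') (B ∪ B') := by
    rw [Set.disjoint_left] at *; intro x hx hx'
    rcases hx with hx | hx <;> rcases hx' with hx' | hx'
    · exact h7 hx hx'
    · rcases h4 hx with rfl | h <;> rcases k5 hx' with h' | h'
      · exact huv h'
      · exact hu₂ h'
      · exact hv₁ (h' ▸ h)
      · exact hdC _ h h'
    · rcases k4 hx with rfl | h <;> rcases h5 hx' with h' | h'
      · exact huv h'
      · exact hu₁ h'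
      · exact hv₂ (h' ▸ h)
      · exact hdC _ h' h
    · exact k7 hx hx'
  apply hminor
  refine MGraph.minor_of_branch ![A ∪ A', W, B ∪ B', W'] ?_ ?_ ?_ ?_
  · intro i j hij
    fin_cases i <;> fin_cases j <;> first | exact absurd rfl hij | assumption | (apply Disjoint.symm; assumption)
  · intro i
    fin_cases i
    · exact ⟨u, Or.inl h1⟩
    · exact h3
    · exact ⟨v, Or.inl h2⟩
    · exact k3
  · intro i
    fin_cases i
    · exact MGraph.connSet_union h10 k10 h1 k1
    · exact h12'
    · exact MGraph.connSet_union h11 k11 h2 k2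
    · exact k12
  · intro i
    fin_cases i
    · exact h13.mono Set.subset_union_left le_rfl
    · exact (h14.mono Set.subset_union_left le_rfl).symm
    · exact k14.mono Set.subset_union_right le_rfl
    · exact (k13.mono Set.subset_union_right le_rfl).symm
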